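/- arXiv:2410.16992 — 5 statements merged into one kernel-verified Lean document; each statement's English description precedes it below -/
import Mathlib

section
/- Let N be a positive integer, d a positive divisor of N, and j an integer with 0 ≤ j ≤ N. The number of functions α : ℤ/Nℤ → {true, false} that take the value true at exactly j elements and satisfy α(i + d) = α(i) for all i ∈ ℤ/Nℤ equals the binomial coefficient C(d, d·j/N) if N divides d·j, and equals 0 otherwise. -/
lemma aux_card (d m : ℕ) [NeZero d] [NeZero (d * m)] (β : ZMod d → Bool) :
    Nat.card {i : ZMod (d * m) // β (ZMod.castHom (dvd_mul_right d m) (ZMod d) i) = true}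
      = m * (Finset.univ.filter fun k => β k = true).card := by
  classical
  set f := ZMod.castHom (dvd_mul_right d m) (ZMod d) with hf
  have hs : Function.Surjective f := ZMod.castHom_surjective _
  have hfib : ∀ k : ZMod d, (Finset.univ.filter fun i => f i = k).card
      = (Finset.univ.filter fun i => f i = 0).card := by
    intro k
    obtain ⟨x, rfl⟩ := hs k
    refine Finset.card_bij' (fun i _ => i - x) (fun i _ => i + x) ?_ ?_ ?_ ?_ <;>
      simp +contextual
  have hsum : ∀ s : Finset (ZMod d), (Finset.univ.filter fun i => f i ∈ s).card
      = s.card * (Finset.univ.filter fun i => f i = 0).card := by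
    intro s
    rw [Finset.card_eq_sum_card_fiberwise (f := f) (t := s) (by intro i; simp)]
    refine Finset.sum_const_nat fun k hk => ?_
    rw [← hfib k, Finset.filter_filter]
    congr 1
    ext i
    simp only [Finset.mem_filter, Finset.mem_univ, true_and]
    constructor
    · exact fun h => h.2
    · rintro rfl; exact ⟨hk, rfl⟩
  have h0 : (Finset.univ.filter fun i => f i = 0).card = m := by
    have := hsum Finset.univ
    simp only [Finset.mem_univ, Finset.filter_true, Finset.card_univ, ZMod.card] at this
    exact (Nat.eq_of_mul_eq_mul_left (Nat.pos_of_ne_zero (NeZero.ne d)) this).symm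
  have := hsum (Finset.univ.filter fun k => β k = true)
  rw [h0] at this
  rw [Nat.card_eq_fintype_card, Fintype.card_subtype, mul_comm m _, ← this]
  simp

lemma aux_per (d m : ℕ) [NeZero d] [NeZero (d * m)] (α : ZMod (d * m) → Bool)
    (h : ∀ i, α (i + (d : ZMod (d * m))) = α i) (i : ZMod (d * m)) :
    α (((ZMod.castHom (dvd_mul_right d m) (ZMod d) i).val : ℕ) : ZMod (d * m)) = α i := by
  have key : ∀ k n : ℕ, α ((n + d * k : ℕ) : ZMod (d * m)) = α (n : ZMod (d * m)) := by
    intro k n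
    induction k with
    | zero => simp
    | succ k ih =>
      rw [← ih, ← h ((n + d * k : ℕ) : ZMod (d * m))]
      congr 1
      push_cast
      ring
  obtain ⟨n, rfl⟩ := ZMod.natCast_zmod_surjective i
  rw [map_natCast, ZMod.val_natCast, ← key (n / d), Nat.mod_add_div]

/-- The number of functions `α : ℤ/Nℤ → Bool` taking the value `true` at exactly `j`
elements and satisfying `α (i + d) = α i` for all `i` equals `C(d, d·j/N)` if `N ∣ d·j`
and `0` otherwise, where `d` is a positive divisor of `N` and `0 ≤ j ≤ N`. -/
theorem stmt_2 (N d j : ℕ) (hN : 0 < N) (hd0 : 0 < d) (hd : d ∣ N) (hj : j ≤ N) :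
    Nat.card {α : ZMod N → Bool //
        Nat.card {i : ZMod N // α i = true} = j ∧ ∀ i : ZMod N, α (i + (d : ZMod N)) = α i}
      = if N ∣ d * j then Nat.choose d (d * j / N) else 0 := by
  classical
  obtain ⟨m, rfl⟩ := hd
  have : NeZero d := ⟨hd0.ne'⟩
  have : NeZero (d * m) := ⟨hN.ne'⟩
  have hm : 0 < m := Nat.pos_of_mul_pos_left hN
  set f := ZMod.castHom (dvd_mul_right d m) (ZMod d) with hf
  have hfd : f (d : ZMod (d * m)) = 0 := by rw [map_natCast]; simp
  have hfv : ∀ k : ZMod d, f ((k.val : ℕ) : ZMod (d * m)) = k := by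
    intro k; rw [map_natCast]; simp
  have e : {α : ZMod (d * m) → Bool // Nat.card {i : ZMod (d * m) // α i = true} = j ∧
        ∀ i : ZMod (d * m), α (i + (d : ZMod (d * m))) = α i}
      ≃ {s : Finset (ZMod d) // m * s.card = j} :=
    { toFun := fun α => ⟨Finset.univ.filter fun k => α.1 ((k.val : ℕ) : ZMod (d * m)) = true, by
        rw [← aux_card d m (fun k => α.1 ((k.val : ℕ) : ZMod (d * m)))]
        simp only [aux_per d m α.1 α.2.2]
        exact α.2.1⟩
      invFun := fun s => ⟨fun i => decide (f i ∈ s.1), by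
        constructor
        · have := aux_card d m (fun k => decide (k ∈ s.1))
          rw [← hf] at this
          rw [this]
          simpa using s.2
        · intro i
          simp only [map_add, hfd, add_zero]⟩
      left_inv := by
        intro α
        ext i
        simp [hf, aux_per d m α.1 α.2.2, -ZMod.castHom_apply, -ZMod.natCast_val]
      right_inv := by
        intro s
        ext k
        simp [hfv, -ZMod.castHom_apply] }
  simp only [Nat.card_congr e, Nat.mul_dvd_mul_iff_left hd0]
  rw [Nat.mul_div_mul_left _ _ hd0]
  rw [Nat.card_eq_fintype_card, Fintype.card_subtype]
  split_ifs with h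
  · obtain ⟨q, rfl⟩ := h
    rw [Nat.mul_div_cancel_left _ hm]
    have : (Finset.univ.filter fun s : Finset (ZMod d) => m * s.card = m * q)
        = Finset.powersetCard q Finset.univ := by
      ext s
      simp [Finset.mem_powersetCard, hm.ne']
    rw [this, Finset.card_powersetCard, Finset.card_univ, ZMod.card]
  · rw [Finset.card_eq_zero, Finset.filter_eq_empty_iff]
    intro s _ hs
    exact h ⟨_, hs.symm⟩
end

section
/- Let n be a positive integer. For each positive divisor d of n, define χ_d : ℤ/nℤ → ℚ by χ_d(k) = d if the canonical projection ℤ/nℤ → ℤ/dℤ sends k to 0, and χ_d(k) = 0 otherwise (χ_d is the number of fixed points of k acting on ℤ/dℤ by translation). Then the family (χ_d), indexed by the positive divisors d of n, is linearly independent over ℚ, and its ℚ-linear span is exactly the set of functions f : ℤ/nℤ → ℚ such that f(k) = f(k') whenever gcd(k, n) = gcd(k', n) (where gcd(k, n) means the gcd of n with any integer representative of k). -/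
theorem aux_chi (n : ℕ) (hn : 0 < n) (d : ℕ) (hd : d ∣ n) (k : ZMod n) :
    ZMod.castHom hd (ZMod d) k = 0 ↔ d ∣ Nat.gcd k.val n := by
  haveI : NeZero n := ⟨hn.ne'⟩
  have h : ZMod.castHom hd (ZMod d) k = ((k.val : ℕ) : ZMod d) := by
    conv_lhs => rw [← ZMod.natCast_zmod_val k]
    rw [map_natCast]
  rw [h, ZMod.natCast_eq_zero_iff]
  exact ⟨fun h => Nat.dvd_gcd h hd, fun h => h.trans (Nat.gcd_dvd_left _ _)⟩

theorem aux_gcd (n : ℕ) (e : ℕ) (he : e ∣ n) :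
    Nat.gcd (e : ZMod n).val n = e := by
  rw [ZMod.val_natCast, Nat.gcd_comm, Nat.gcd_comm, ← Nat.gcd_rec, Nat.gcd_eq_right he]

theorem aux_sum (n : ℕ) (c : n.divisors → ℚ) (C : ℕ → ℚ) (hn : 0 < n)
    (hC : ∀ d : n.divisors, C d = c d * ((d : ℕ) : ℚ)) (m : ℕ) (hm : m ∣ n) :
    ∑ d : n.divisors, c d * (if (d : ℕ) ∣ m then ((d : ℕ) : ℚ) else 0)
      = ∑ d ∈ m.divisors, C d := by
  have h1 : ∀ d : n.divisors, c d * (if (d : ℕ) ∣ m then ((d : ℕ) : ℚ) else 0)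
      = (fun x : ℕ => if x ∣ m then C x else 0) d := by
    intro d
    simp only [hC]
    split_ifs <;> simp
  rw [Finset.sum_congr rfl (fun d _ => h1 d),
    Finset.sum_coe_sort n.divisors (fun x : ℕ => if x ∣ m then C x else 0),
    ← Finset.sum_filter]
  congr 1
  ext x
  simp only [Finset.mem_filter, Nat.mem_divisors]
  constructor
  · rintro ⟨⟨_, h⟩, h'⟩
    exact ⟨h', (Nat.pos_of_dvd_of_pos hm hn).ne'⟩
  · rintro ⟨h, _⟩
    exact ⟨⟨h.trans hm, hn.ne'⟩, h⟩

/-- For `n > 0`, the functions `χ_d : ℤ/nℤ → ℚ` (for `d ∣ n`) counting fixed points of the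
translation action on `ℤ/dℤ` — i.e. `χ_d(k) = d` if `k ≡ 0 (mod d)` and `0` otherwise —
are linearly independent over `ℚ`, and their span is exactly the set of functions
`f : ℤ/nℤ → ℚ` with `f(k) = f(k')` whenever `gcd(k, n) = gcd(k', n)`. -/
theorem stmt_7 (n : ℕ) (hn : 0 < n) :
    LinearIndependent ℚ (fun d : n.divisors => fun k : ZMod n =>
      if ZMod.castHom (Nat.dvd_of_mem_divisors d.2) (ZMod (d : ℕ)) k = 0
        then ((d : ℕ) : ℚ) else 0) ∧
    (Submodule.span ℚ (Set.range (fun d : n.divisors => fun k : ZMod n =>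
        if ZMod.castHom (Nat.dvd_of_mem_divisors d.2) (ZMod (d : ℕ)) k = 0
          then ((d : ℕ) : ℚ) else 0)) : Set (ZMod n → ℚ))
      = {f : ZMod n → ℚ |
          ∀ k k' : ZMod n, Nat.gcd k.val n = Nat.gcd k'.val n → f k = f k'} := by
  simp only [aux_chi n hn]
  refine ⟨?_, ?_⟩
  · rw [Fintype.linearIndependent_iff]
    intro g hg
    have key : ∀ e : ℕ, ∀ he : e ∈ n.divisors, g ⟨e, he⟩ = 0 := by
      intro e
      induction e using Nat.strong_induction_on with
      | _ e ih =>
        intro he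
        have hen := Nat.dvd_of_mem_divisors he
        have he0 : 0 < e := Nat.pos_of_mem_divisors he
        have h := congrFun hg (e : ZMod n)
        simp only [Finset.sum_apply, Pi.smul_apply, smul_eq_mul, Pi.zero_apply,
          aux_gcd n e hen] at h
        rw [Finset.sum_eq_single (⟨e, he⟩ : n.divisors)] at h
        · simpa [he0.ne'] using h
        · intro b _ hb
          by_cases hbe : (b : ℕ) ∣ e
          · have hlt : (b : ℕ) < e := lt_of_le_of_ne (Nat.le_of_dvd he0 hbe)
              (fun h => hb (Subtype.ext h))
            have := ih b hlt b.2
            simp only [Subtype.coe_eta] at this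
            rw [this, zero_mul]
          · simp [hbe]
        · intro h
          exact absurd (Finset.mem_univ _) h
    exact fun i => key i i.2
  · ext f
    simp only [SetLike.mem_coe, Set.mem_setOf_eq]
    rw [Submodule.mem_span_range_iff_exists_fun]
    constructor
    · rintro ⟨c, rfl⟩ k k' h
      simp only [Finset.sum_apply, Pi.smul_apply, h]
    · intro hf
      let C : ℕ → ℚ := fun d => ∑ x ∈ d.divisorsAntidiagonal,
        ((ArithmeticFunction.moebius x.1 : ℤ) : ℚ) * f ((x.2 : ℕ) : ZMod n)
      have hC : ∀ m > 0, ∑ d ∈ m.divisors, C d = f ((m : ℕ) : ZMod n) :=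
        (ArithmeticFunction.sum_eq_iff_sum_mul_moebius_eq
          (f := C) (g := fun m : ℕ => f (m : ZMod n))).2 (fun m _ => rfl)
      refine ⟨fun d => C d / ((d : ℕ) : ℚ), ?_⟩
      ext k
      have hg : Nat.gcd k.val n ∣ n := Nat.gcd_dvd_right _ _
      simp only [Finset.sum_apply, Pi.smul_apply, smul_eq_mul]
      rw [aux_sum n (fun d => C d / ((d : ℕ) : ℚ)) C hn ?_ _ hg,
        hC _ (Nat.pos_of_dvd_of_pos hg hn)]
      · exact hf _ _ (aux_gcd n _ hg)
      · intro d
        have : ((d : ℕ) : ℚ) ≠ 0 := by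
          exact_mod_cast (Nat.pos_of_mem_divisors d.2).ne'
        field_simp
end

section
/- Let h and N be positive integers, and let π be the permutation of (ℤ/hℤ)^N defined by π(x₁, x₂, …, x_N) = (x_N + 1, x₁, …, x_{N−1}). Then for every positive integer j, the power π^j has a fixed point if and only if h·gcd(N, j) divides j, and in that case π^j has exactly h^{gcd(N, j)} fixed points. -/
theorem quasi_mul {h : ℕ} (D : ℤ) (a : ZMod h) (Y : ℤ → ZMod h)
    (hY : ∀ n, Y (n + D) = Y n + a) (k n : ℤ) : Y (n + D * k) = Y n + k * a := by
  induction k using Int.induction_on with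
  | zero => simp
  | succ i ih =>
    have := hY (n + D * i)
    rw [show n + D * ((i : ℤ) + 1) = n + D * i + D by ring, this, ih]
    push_cast; ring
  | pred i ih =>
    have := hY (n + D * (-(i : ℤ) - 1))
    rw [show n + D * (-(i : ℤ) - 1) + D = n + D * (-(i : ℤ)) by ring, ih] at this
    rw [eq_sub_of_add_eq this.symm]
    push_cast; ring

/-- Quasi-periodic functions on the integers correspond to functions on `ZMod D`. -/
def quasiEquiv (h D : ℕ) (hD : 0 < D) (a : ZMod h) :
    (ZMod D → ZMod h) ≃ {Y : ℤ → ZMod h // ∀ n, Y (n + D) = Y n + a} where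
  toFun x := ⟨fun n => x (n : ZMod D) + ((n / (D : ℤ) : ℤ) : ZMod h) * a, by
    intro n
    have hD' : (D : ℤ) ≠ 0 := by positivity
    have h1 : (n + (D : ℤ)) / (D : ℤ) = n / D + 1 := by
      rw [Int.add_ediv_of_dvd_right (dvd_refl _), Int.ediv_self hD']
    simp only [h1]
    push_cast
    simp only [ZMod.natCast_self, add_zero]
    ring⟩
  invFun Y i := Y.1 (i.val : ℤ)
  left_inv x := by
    have : NeZero D := ⟨hD.ne'⟩
    funext i
    have h1 : ((i.val : ℤ)) / (D : ℤ) = 0 :=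
      Int.ediv_eq_zero_of_lt (by positivity) (by exact_mod_cast ZMod.val_lt i)
    simp only [h1]
    simp
  right_inv Y := by
    have : NeZero D := ⟨hD.ne'⟩
    apply Subtype.ext
    funext n
    simp only [ZMod.val_intCast]
    rw [← quasi_mul (D : ℤ) a Y.1 Y.2, Int.emod_add_mul_ediv]

theorem quasi_shift (h N : ℕ) (hN : 0 < N)
    (f : (ZMod N → ZMod h) → ZMod N → ZMod h)
    (hf : ∀ x i, f x i = x (i - 1) + if i = 0 then 1 else 0) (x : ZMod N → ZMod h) (n : ℤ) :
    (quasiEquiv h N hN (-1) (f x)).1 (n + 1) = (quasiEquiv h N hN (-1) x).1 n := by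
  have hN' : (0 : ℤ) < N := by exact_mod_cast hN
  have key : (n + 1) / (N : ℤ) = n / N + if (N : ℤ) ∣ n + 1 then 1 else 0 := by
    have e := Int.emod_add_mul_ediv n N
    have l := Int.emod_lt_of_pos n hN'
    have p := Int.emod_nonneg n hN'.ne'
    split_ifs with hd
    · obtain ⟨c, hc⟩ := hd
      have hc' : c = n / N + 1 := by
        have h1 : (N : ℤ) * (c - n / N) = n % N + 1 := by linarith
        have h2 : 0 < c - n / N := by
          by_contra hcon
          nlinarith
        have h3 : c - n / N < 2 := by
          by_contra hcon
          nlinarith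
        omega
      rw [hc, Int.mul_ediv_cancel_left _ hN'.ne', hc']
    · have hlt : n % N + 1 < N := by
        rcases lt_or_eq_of_le (show n % N + 1 ≤ N by omega) with h1 | h1
        · exact h1
        · exact absurd ⟨n / N + 1, by linarith⟩ hd
      rw [add_zero]
      have h1 : n + 1 = (n % N + 1) + N * (n / N) := by linarith
      conv_lhs => rw [h1]
      rw [Int.add_mul_ediv_left _ _ hN'.ne', Int.ediv_eq_zero_of_lt (by omega) hlt, zero_add]
  have hz : ((n : ZMod N) + 1 = 0) ↔ (N : ℤ) ∣ n + 1 := by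
    rw [← ZMod.intCast_zmod_eq_zero_iff_dvd]; push_cast; rfl
  simp only [quasiEquiv, Equiv.coe_fn_mk, hf, key]
  push_cast
  simp only [hz, add_sub_cancel_right]
  split_ifs <;> ring

theorem quasi_shift_iter (h N : ℕ) (hN : 0 < N)
    (f : (ZMod N → ZMod h) → ZMod N → ZMod h)
    (hf : ∀ x i, f x i = x (i - 1) + if i = 0 then 1 else 0) (j : ℕ) (x : ZMod N → ZMod h)
    (n : ℤ) :
    (quasiEquiv h N hN (-1) (f^[j] x)).1 (n + j) = (quasiEquiv h N hN (-1) x).1 n := by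
  induction j generalizing n with
  | zero => simp
  | succ j ih =>
    rw [Function.iterate_succ_apply', ← ih n, ← quasi_shift h N hN f hf (f^[j] x)]
    push_cast
    rw [add_assoc]

theorem fix_iff (h N : ℕ) (hN : 0 < N)
    (f : (ZMod N → ZMod h) → ZMod N → ZMod h)
    (hf : ∀ x i, f x i = x (i - 1) + if i = 0 then 1 else 0) (j : ℕ) (x : ZMod N → ZMod h) :
    f^[j] x = x ↔ ∀ n : ℤ, (quasiEquiv h N hN (-1) x).1 (n + j)
      = (quasiEquiv h N hN (-1) x).1 n := by
  constructor
  · intro hx n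
    have := quasi_shift_iter h N hN f hf j x n
    rwa [hx] at this
  · intro hx
    apply (quasiEquiv h N hN (-1)).injective
    apply Subtype.ext
    funext n
    have h1 := quasi_shift_iter h N hN f hf j x (n - j)
    have h2 := hx (n - j)
    rw [sub_add_cancel] at h1 h2
    rw [h1, h2]

/-- Let `π` be the permutation of `(ℤ/hℤ)^N` given by
`π(x₁, …, x_N) = (x_N + 1, x₁, …, x_{N-1})` (indexed by `ℤ/Nℤ`). For every positive
integer `j`, `π^j` has a fixed point iff `h·gcd(N, j)` divides `j`, and in that case it
has exactly `h^{gcd(N, j)}` fixed points. -/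
theorem stmt_9 (h N : ℕ) (hh : 0 < h) (hN : 0 < N)
    (f : (ZMod N → ZMod h) → ZMod N → ZMod h)
    (hf : ∀ x i, f x i = x (i - 1) + if i = 0 then 1 else 0)
    (j : ℕ) (hj : 0 < j) :
    ((∃ x, f^[j] x = x) ↔ h * Nat.gcd N j ∣ j) ∧
    (h * Nat.gcd N j ∣ j →
      Nat.card {x : ZMod N → ZMod h // f^[j] x = x} = h ^ Nat.gcd N j) := by
  have hd : 0 < Nat.gcd N j := Nat.gcd_pos_of_pos_left _ hN
  obtain ⟨M, hM⟩ := Nat.gcd_dvd_left N j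
  obtain ⟨m, hm⟩ := Nat.gcd_dvd_right N j
  have bez := Nat.gcd_eq_gcd_ab N j
  set a := Nat.gcdA N j
  set b := Nat.gcdB N j
  set d := Nat.gcd N j with hdd
  have hMz : (N : ℤ) = d * M := by exact_mod_cast hM
  have hmz : (j : ℤ) = d * m := by exact_mod_cast hm
  have bez' : (M : ℤ) * a + m * b = 1 := by
    have hdz : (d : ℤ) ≠ 0 := by exact_mod_cast hd.ne'
    apply mul_left_cancel₀ hdz
    rw [hMz, hmz] at bez
    linarith
  have hdiv : h * d ∣ j ↔ ((m : ℤ) : ZMod h) = 0 := by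
    rw [Int.cast_natCast, ZMod.natCast_eq_zero_iff]
    conv_lhs => rw [hm, mul_comm h d]
    exact Nat.mul_dvd_mul_iff_left hd
  have bezh : ((M : ℤ) : ZMod h) * (a : ZMod h) + ((m : ℤ) : ZMod h) * (b : ZMod h) = 1 := by
    exact_mod_cast congrArg (Int.cast : ℤ → ZMod h) bez'
  have stepd : ∀ Y : ℤ → ZMod h, (∀ n, Y (n + N) = Y n + -1) → (∀ n : ℤ, Y (n + j) = Y n) →
      ∀ n, Y (n + d) = Y n + -(a : ZMod h) := by
    intro Y h1 h2 n
    have e1 := quasi_mul (N : ℤ) (-1) Y h1 a n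
    have e2 := quasi_mul (j : ℤ) 0 Y (by simpa using h2) b (n + N * a)
    rw [add_assoc, ← bez, e1] at e2
    rw [e2]; ring
  have forward : (∃ x, f^[j] x = x) → h * d ∣ j := by
    rintro ⟨x, hx⟩
    rw [hdiv]
    have hx' := (fix_iff h N hN f hf j x).1 hx
    have hY := (quasiEquiv h N hN (-1) x).2
    generalize (quasiEquiv h N hN (-1) x).1 = Y at hx' hY
    have hs := stepd Y hY hx'
    have e1 := quasi_mul (d : ℤ) _ Y hs M 0
    have e2 := quasi_mul (d : ℤ) _ Y hs m 0
    rw [← hMz, hY] at e1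
    rw [← hmz, hx'] at e2
    have e1' : ((M : ℤ) : ZMod h) * (a : ZMod h) = 1 := by linear_combination e1
    have e2' : ((m : ℤ) : ZMod h) * (a : ZMod h) = 0 := by linear_combination e2
    linear_combination ((M : ℤ) : ZMod h) * e2' - ((m : ℤ) : ZMod h) * e1'
  have count : h * d ∣ j →
      Nat.card {x : ZMod N → ZMod h // f^[j] x = x} = h ^ d := by
    intro hdv
    have hm0 := hdiv.1 hdv
    rw [hm0, zero_mul, add_zero] at bezh
    have E1 : {x : ZMod N → ZMod h // f^[j] x = x} ≃
        {Y : {Y : ℤ → ZMod h // ∀ n, Y (n + N) = Y n + -1} // ∀ n : ℤ, Y.1 (n + j) = Y.1 n} :=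
      (quasiEquiv h N hN (-1)).subtypeEquiv (fun x => fix_iff h N hN f hf j x)
    have E2 : {Y : {Y : ℤ → ZMod h // ∀ n, Y (n + N) = Y n + -1} //
          ∀ n : ℤ, Y.1 (n + j) = Y.1 n} ≃
        {Y : ℤ → ZMod h // (∀ n, Y (n + N) = Y n + -1) ∧ ∀ n : ℤ, Y (n + j) = Y n} :=
      Equiv.subtypeSubtypeEquivSubtypeInter (fun Y : ℤ → ZMod h => ∀ n, Y (n + N) = Y n + -1)
        (fun Y => ∀ n : ℤ, Y (n + j) = Y n)
    have E3 : {Y : ℤ → ZMod h // (∀ n, Y (n + N) = Y n + -1) ∧ ∀ n : ℤ, Y (n + j) = Y n} ≃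
        {Y : ℤ → ZMod h // ∀ n, Y (n + d) = Y n + -(a : ZMod h)} := by
      refine Equiv.subtypeEquivRight fun Y => ⟨fun hY => stepd Y hY.1 hY.2, fun hY => ⟨?_, ?_⟩⟩
      · intro n
        rw [hMz, quasi_mul (d : ℤ) _ Y hY M n]
        linear_combination -bezh
      · intro n
        rw [hmz, quasi_mul (d : ℤ) _ Y hY m n, hm0]
        ring
    rw [Nat.card_congr (((E1.trans E2).trans E3).trans (quasiEquiv h d hd _).symm)]
    have : NeZero d := ⟨hd.ne'⟩
    rw [Nat.card_fun, Nat.card_zmod, Nat.card_zmod]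
  refine ⟨⟨forward, fun hdv => ?_⟩, count⟩
  have hc := count hdv
  have hpos : 0 < Nat.card {x : ZMod N → ZMod h // f^[j] x = x} := by
    rw [hc]; positivity
  obtain ⟨⟨x, hx⟩⟩ := (Nat.card_pos_iff.1 hpos).1
  exact ⟨x, hx⟩
end

section
/- Let n, m be coprime positive integers and r a positive integer. Let S be a multiset of r complex numbers each of which is an n-th root of unity, and T a multiset of r complex numbers each of which is an m-th root of unity. Let μ_{nm} ⊂ ℂ^× denote the group of nm-th roots of unity, and let Γ = {z ∈ μ_{nm} : z^m·S = S and z^n·T = T} be the stabilizer of the configuration (S, T) under the action z·(S, T) = (z^m·S, z^n·T). Then Γ is a subgroup of μ_{nm} whose order divides gcd(r, nm). -/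
theorem pow_card_of_map_mul_eq (c : ℂ) (n : ℕ) (hn : 0 < n) (S : Multiset ℂ)
    (hS : ∀ z ∈ S, z ^ n = 1) (h : S.map (fun w => c * w) = S) :
    c ^ Multiset.card S = 1 := by
  have h1 : S.prod ≠ 0 := by
    intro h0
    have h2 := hS 0 (Multiset.prod_eq_zero_iff.1 h0)
    rw [zero_pow hn.ne'] at h2
    exact zero_ne_one h2
  have h3 := congrArg Multiset.prod h
  rw [Multiset.prod_map_mul] at h3
  simp only [Multiset.map_const', Multiset.prod_replicate, Multiset.map_id'] at h3
  exact mul_right_cancel₀ h1 (h3.trans (one_mul _).symm)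

theorem map_inv_mul_eq (c : ℂˣ) (k : ℕ) (S : Multiset ℂ)
    (h : S.map (fun w => (c : ℂ) ^ k * w) = S) :
    S.map (fun w => ((c⁻¹ : ℂˣ) : ℂ) ^ k * w) = S := by
  conv_lhs => rw [← h]
  rw [Multiset.map_map]
  have : ((fun w => ((c⁻¹ : ℂˣ) : ℂ) ^ k * w) ∘ fun w => (c : ℂ) ^ k * w) = id := by
    funext w
    simp [← mul_assoc, ← mul_pow]
  rw [this, Multiset.map_id]

theorem map_mul_mul_eq (a b : ℂˣ) (k : ℕ) (S : Multiset ℂ)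
    (ha : S.map (fun w => (a : ℂ) ^ k * w) = S)
    (hb : S.map (fun w => (b : ℂ) ^ k * w) = S) :
    S.map (fun w => ((a * b : ℂˣ) : ℂ) ^ k * w) = S := by
  have : (fun w => ((a * b : ℂˣ) : ℂ) ^ k * w) =
      (fun w => (a : ℂ) ^ k * w) ∘ (fun w => (b : ℂ) ^ k * w) := by
    funext w
    simp [← mul_assoc, ← mul_pow]
  rw [this, ← Multiset.map_map, hb, ha]

/-- Let `n, m` be coprime positive integers, `r > 0`, `S` a multiset of `r` complex
`n`-th roots of unity and `T` a multiset of `r` complex `m`-th roots of unity. The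
stabilizer `Γ = {z ∈ μ_{nm} : z^m·S = S and z^n·T = T}` of the configuration `(S, T)`
is a subgroup of `ℂ^×` whose order divides `gcd(r, nm)`. -/
theorem stmt_13 (n m r : ℕ) (hn : 0 < n) (hm : 0 < m) (hr : 0 < r)
    (hnm : Nat.Coprime n m)
    (S T : Multiset ℂ)
    (hScard : Multiset.card S = r) (hTcard : Multiset.card T = r)
    (hS : ∀ z ∈ S, z ^ n = 1) (hT : ∀ z ∈ T, z ^ m = 1) :
    ∃ Γ : Subgroup ℂˣ,
      (Γ : Set ℂˣ) = {z : ℂˣ | (z : ℂ) ^ (n * m) = 1 ∧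
          S.map (fun w => (z : ℂ) ^ m * w) = S ∧
          T.map (fun w => (z : ℂ) ^ n * w) = T} ∧
      Nat.card Γ ∣ Nat.gcd r (n * m) := by
  let Γ : Subgroup ℂˣ :=
    { carrier := {z : ℂˣ | (z : ℂ) ^ (n * m) = 1 ∧
          S.map (fun w => (z : ℂ) ^ m * w) = S ∧
          T.map (fun w => (z : ℂ) ^ n * w) = T}
      mul_mem' := by
        rintro a b ⟨a1, a2, a3⟩ ⟨b1, b2, b3⟩
        refine ⟨?_, map_mul_mul_eq a b m S a2 b2, map_mul_mul_eq a b n T a3 b3⟩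
        rw [Units.val_mul, mul_pow, a1, b1, one_mul]
      one_mem' := by simp
      inv_mem' := by
        rintro a ⟨a1, a2, a3⟩
        refine ⟨?_, map_inv_mul_eq a m S a2, map_inv_mul_eq a n T a3⟩
        rw [Units.val_inv_eq_inv_val, inv_pow, a1, inv_one] }
  refine ⟨Γ, rfl, ?_⟩
  have hle : Γ ≤ rootsOfUnity (Nat.gcd r (n * m)) ℂ := by
    rintro z ⟨z1, z2, z3⟩
    have e1 := pow_card_of_map_mul_eq _ n hn S hS z2
    have e2 := pow_card_of_map_mul_eq _ m hm T hT z3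
    rw [hScard, ← pow_mul] at e1
    rw [hTcard, ← pow_mul] at e2
    have d1 := orderOf_dvd_of_pow_eq_one e1
    have d2 := orderOf_dvd_of_pow_eq_one e2
    have d3 := orderOf_dvd_of_pow_eq_one z1
    have d4 := Nat.dvd_gcd d1 d2
    rw [Nat.gcd_mul_right, hnm.symm.gcd_eq_one, one_mul] at d4
    rw [mem_rootsOfUnity']
    exact orderOf_dvd_iff_pow_eq_one.1 (Nat.dvd_gcd d4 d3)
  have hk : NeZero (Nat.gcd r (n * m)) := ⟨(Nat.gcd_pos_of_pos_left _ hr).ne'⟩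
  have hc := Subgroup.card_dvd_of_le hle
  rwa [Complex.card_rootsOfUnity] at hc
end

section
/- Let M and M' be 2 × 2 invertible complex matrices all of whose entries are nonzero, with entries M = (a, b; c, d) and M' = (a', b'; c', d'). Then there exist invertible diagonal matrices D, D' ∈ GL₂(ℂ) with M' = D·M·D' if and only if a'd'/(b'c') = ad/(bc). -/
/-- For `2 × 2` invertible complex matrices `M, M'` with all entries nonzero, there exist
invertible diagonal matrices `D, D'` with `M' = D·M·D'` if and only if
`a'd'/(b'c') = ad/(bc)`, where `M = (a, b; c, d)` and `M' = (a', b'; c', d')`. -/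
theorem stmt_16 (M M' : Matrix (Fin 2) (Fin 2) ℂ)
    (hM : IsUnit M) (hM' : IsUnit M')
    (hMnz : ∀ i j, M i j ≠ 0) (hM'nz : ∀ i j, M' i j ≠ 0) :
    (∃ D D' : Matrix (Fin 2) (Fin 2) ℂ, D.IsDiag ∧ IsUnit D ∧ D'.IsDiag ∧ IsUnit D' ∧
        M' = D * M * D') ↔
      M' 0 0 * M' 1 1 / (M' 0 1 * M' 1 0) = M 0 0 * M 1 1 / (M 0 1 * M 1 0) := by
  have h00 := hMnz 0 0
  have h01 := hMnz 0 1
  have h10 := hMnz 1 0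
  have h11 := hMnz 1 1
  have k00 := hM'nz 0 0
  have k01 := hM'nz 0 1
  have k10 := hM'nz 1 0
  have k11 := hM'nz 1 1
  constructor
  · rintro ⟨D, D', hD, hDu, hD', hDu', h⟩
    have d01 : D 0 1 = 0 := hD (by decide)
    have d10 : D 1 0 = 0 := hD (by decide)
    have e01 : D' 0 1 = 0 := hD' (by decide)
    have e10 : D' 1 0 = 0 := hD' (by decide)
    have m : ∀ i j, M' i j = (D * M * D') i j := fun i j => by rw [← h]
    have m00 := m 0 0
    have m01 := m 0 1
    have m10 := m 1 0
    have m11 := m 1 1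
    simp only [Matrix.mul_apply, Fin.sum_univ_two, d01, d10, e01, e10, mul_zero, zero_mul,
      add_zero, zero_add] at m00 m01 m10 m11
    rw [div_eq_div_iff (mul_ne_zero k01 k10) (mul_ne_zero h01 h10), m00, m01, m10, m11]
    ring
  · intro h
    rw [div_eq_div_iff (mul_ne_zero k01 k10) (mul_ne_zero h01 h10)] at h
    refine ⟨Matrix.diagonal ![1, M' 1 0 * M 0 0 / (M' 0 0 * M 1 0)],
      Matrix.diagonal ![M' 0 0 / M 0 0, M' 0 1 / M 0 1],
      Matrix.isDiag_diagonal _, ?_, Matrix.isDiag_diagonal _, ?_, ?_⟩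
    · rw [Matrix.isUnit_iff_isUnit_det, Matrix.det_diagonal, isUnit_iff_ne_zero]
      simp [Fin.prod_univ_two, *]
    · rw [Matrix.isUnit_iff_isUnit_det, Matrix.det_diagonal, isUnit_iff_ne_zero]
      simp [Fin.prod_univ_two, *]
    · ext i j
      rw [Matrix.mul_diagonal, Matrix.diagonal_mul]
      fin_cases i <;> fin_cases j <;> simp <;> field_simp
      linear_combination h
end
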